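/- arXiv:1910.14422 — 4 statements merged into one kernel-verified Lean document; each statement's English description precedes it below -/
import Mathlib

section
/- Let V be a positive integer, let w, ĝ ∈ ℂ^V, and let σ ≥ 0. Then the value (max(|⟨w, ĝ⟩| − σ‖w‖, 0))² is the least element of the set { |⟨w, ĝ + e⟩|² : e ∈ ℂ^V, ‖e‖ ≤ σ }; that is, this value is attained by some error vector e with ‖e‖ ≤ σ and is a lower bound for |⟨w, ĝ + e⟩|² over all e with ‖e‖ ≤ σ. -/
open scoped ComplexInnerProductSpace

section WorstCaseInner

variable {𝕜 E : Type*} [RCLike 𝕜] [NormedAddCommGroup E] [InnerProductSpace 𝕜 E]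

theorem max_norm_inner_sub_le_norm_inner_add (w g : E) {e : E} {σ : ℝ} (he : ‖e‖ ≤ σ) :
    max (‖inner 𝕜 w g‖ - σ * ‖w‖) 0 ≤ ‖inner 𝕜 w (g + e)‖ := by
  refine max_le ?_ (norm_nonneg _)
  have h₁ : ‖inner 𝕜 w e‖ ≤ σ * ‖w‖ :=
    (norm_inner_le_norm w e).trans (by rw [mul_comm]; gcongr)
  have h₂ := norm_sub_le_norm_add (inner 𝕜 w g) (inner 𝕜 w e)
  rw [inner_add_right]
  linarith

theorem norm_inner_add_neg_smul (w g : E) (t : ℝ) :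
    ‖inner 𝕜 w (g + -((t : 𝕜) * inner 𝕜 w g) • w)‖ =
      ‖inner 𝕜 w g‖ * |1 - t * ‖w‖ ^ 2| := by
  have h : inner 𝕜 w (g + -((t : 𝕜) * inner 𝕜 w g) • w) =
      inner 𝕜 w g * ((1 - t * ‖w‖ ^ 2 : ℝ) : 𝕜) := by
    rw [inner_add_right, inner_smul_right, inner_self_eq_norm_sq_to_K]
    push_cast
    ring
  rw [h, norm_mul, RCLike.norm_ofReal]

theorem exists_norm_le_norm_inner_add_eq (w g : E) {σ : ℝ} (hσ : 0 ≤ σ) :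
    ∃ e : E, ‖e‖ ≤ σ ∧
      ‖inner 𝕜 w (g + e)‖ = max (‖inner 𝕜 w g‖ - σ * ‖w‖) 0 := by
  rcases eq_or_ne w 0 with rfl | hw
  · exact ⟨0, by simpa using hσ, by simp⟩
  have hw' : 0 < ‖w‖ := norm_pos_iff.2 hw
  rcases le_or_gt ‖inner 𝕜 w g‖ (σ * ‖w‖) with h | h
  · refine ⟨-(((1 / ‖w‖ ^ 2 : ℝ) : 𝕜) * inner 𝕜 w g) • w, ?_, ?_⟩
    · rw [norm_smul, norm_neg, norm_mul, RCLike.norm_ofReal, abs_of_nonneg (by positivity)]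
      calc 1 / ‖w‖ ^ 2 * ‖inner 𝕜 w g‖ * ‖w‖ = ‖inner 𝕜 w g‖ / ‖w‖ := by field_simp
        _ ≤ σ := (div_le_iff₀ hw').2 h
    · rw [norm_inner_add_neg_smul, max_eq_right (by linarith),
        one_div_mul_cancel (by positivity), sub_self, abs_zero, mul_zero]
  · have ha : 0 < ‖inner 𝕜 w g‖ := lt_of_le_of_lt (by positivity) h
    refine ⟨-(((σ / (‖w‖ * ‖inner 𝕜 w g‖) : ℝ) : 𝕜) * inner 𝕜 w g) • w, ?_, ?_⟩
    · rw [norm_smul, norm_neg, norm_mul, RCLike.norm_ofReal, abs_of_nonneg (by positivity)]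
      exact le_of_eq (by field_simp)
    · have ht : 1 - σ / (‖w‖ * ‖inner 𝕜 w g‖) * ‖w‖ ^ 2 =
          (‖inner 𝕜 w g‖ - σ * ‖w‖) / ‖inner 𝕜 w g‖ := by
        field_simp
      rw [norm_inner_add_neg_smul, max_eq_left (by linarith), ht,
        abs_of_pos (div_pos (sub_pos.2 h) ha), mul_div_cancel₀ _ ha.ne']

end WorstCaseInner

/-- `(max (|⟨w, g⟩| − σ‖w‖) 0)²` is the least element of the set of
effective channel gains `|⟨w, g + e⟩|²` over CSI errors `e` with `‖e‖ ≤ σ`. -/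
theorem stmt_0 (V : ℕ) (hV : 0 < V) (w g : EuclideanSpace ℂ (Fin V)) (σ : ℝ) (hσ : 0 ≤ σ) :
    IsLeast {x : ℝ | ∃ e : EuclideanSpace ℂ (Fin V), ‖e‖ ≤ σ ∧ x = ‖⟪w, g + e⟫‖ ^ 2}
      ((max (‖⟪w, g⟫‖ - σ * ‖w‖) 0) ^ 2) := by
  constructor
  · obtain ⟨e, he, h⟩ := exists_norm_le_norm_inner_add_eq (𝕜 := ℂ) w g hσ
    exact ⟨e, he, by rw [h]⟩
  · rintro _ ⟨e, he, rfl⟩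
    exact pow_le_pow_left₀ (le_max_right _ _) (max_norm_inner_sub_le_norm_inner_add w g he) 2
end

section
/- Let V be a positive integer, let w, ĝ ∈ ℂ^V with w ≠ 0 and ⟨w, ĝ⟩ ≠ 0, let σ > 0, and let λ* = σ⁻¹‖w‖·|⟨w, ĝ⟩| − ‖w‖². Set e* = −(⟨w, ĝ⟩/(‖w‖² + λ*))·w. Then ‖e*‖ = σ and |⟨w, ĝ + e*⟩|² = ((σ²‖w‖²)^{1/2} − (|⟨w, ĝ⟩|²)^{1/2})² = (|⟨w, ĝ⟩| − σ‖w‖)². -/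
open scoped ComplexInnerProductSpace

/-- with multiplier `λ* = σ⁻¹‖w‖|⟨w, ĝ⟩| − ‖w‖²` and
`e* = −(⟨w, ĝ⟩/(‖w‖² + λ*))·w`, one has `‖e*‖ = σ` and the worst-case objective value
`|⟨w, ĝ + e*⟩|² = ((σ²‖w‖²)^{1/2} − (|⟨w, ĝ⟩|²)^{1/2})² = (|⟨w, ĝ⟩| − σ‖w‖)²`. -/
theorem stmt_12 (V : ℕ) (hV : 0 < V) (w g : EuclideanSpace ℂ (Fin V)) (hw : w ≠ 0)
    (hg : ⟪w, g⟫ ≠ 0) (σ : ℝ) (hσ : 0 < σ)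
    (lamstar : ℝ) (hlam : lamstar = σ⁻¹ * ‖w‖ * ‖⟪w, g⟫‖ - ‖w‖ ^ 2)
    (estar : EuclideanSpace ℂ (Fin V))
    (hestar : estar = (-(⟪w, g⟫ / ((‖w‖ ^ 2 + lamstar : ℝ) : ℂ))) • w) :
    ‖estar‖ = σ ∧
      ‖⟪w, g + estar⟫‖ ^ 2
        = (Real.sqrt (σ ^ 2 * ‖w‖ ^ 2) - Real.sqrt (‖⟪w, g⟫‖ ^ 2)) ^ 2 ∧
      (Real.sqrt (σ ^ 2 * ‖w‖ ^ 2) - Real.sqrt (‖⟪w, g⟫‖ ^ 2)) ^ 2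
        = (‖⟪w, g⟫‖ - σ * ‖w‖) ^ 2 := by
  have hw0 : 0 < ‖w‖ := norm_pos_iff.mpr hw
  have ha : 0 < ‖⟪w, g⟫‖ := norm_pos_iff.mpr hg
  have hD : ‖w‖ ^ 2 + lamstar = σ⁻¹ * ‖w‖ * ‖⟪w, g⟫‖ := by rw [hlam]; ring
  rw [hD] at hestar
  have hsqrt : Real.sqrt (σ ^ 2 * ‖w‖ ^ 2) = σ * ‖w‖ := by
    rw [← mul_pow, Real.sqrt_sq (by positivity)]
  rw [hsqrt, Real.sqrt_sq ha.le]
  refine ⟨?_, ?_, by ring⟩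
  · rw [hestar, norm_smul, norm_neg, norm_div, Complex.norm_of_nonneg (by positivity)]
    field_simp
  · have hinner : ⟪w, g + estar⟫ = ⟪w, g⟫ * ((1 - σ * ‖w‖ / ‖⟪w, g⟫‖ : ℝ) : ℂ) := by
      have hwC : (‖w‖ : ℂ) ≠ 0 := by exact_mod_cast hw0.ne'
      have haC : (‖⟪w, g⟫‖ : ℂ) ≠ 0 := by exact_mod_cast ha.ne'
      have hσC : (σ : ℂ) ≠ 0 := by exact_mod_cast hσ.ne'
      rw [hestar, inner_add_right, inner_smul_right, inner_self_eq_norm_sq_to_K]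
      push_cast
      simp only [Complex.coe_algebraMap]
      field_simp
      ring
    rw [hinner, norm_mul, Complex.norm_real, mul_pow, Real.norm_eq_abs, sq_abs]
    field_simp
    ring
end

section
/- Let V be a positive integer, let σ ≥ 0, let w ∈ ℂ^V, let ι be a finite index set, and let ĝ : ι → ℂ^V be a family of channel estimates such that σ‖w‖ < |⟨w, ĝ_i⟩| for every i ∈ ι. Then the sum over i ∈ ι of the reciprocals of the minima min{ |⟨w, ĝ_i + e⟩|² : ‖e‖ ≤ σ } equals the sum over i ∈ ι of ((|⟨w, ĝ_i⟩| − σ‖w‖)²)⁻¹; consequently, for any real ε, the robust constraint ∑_i (min_{‖e‖≤σ} |⟨w, ĝ_i + e⟩|²)⁻¹ ≤ ε holds if and only if ∑_i ((wᴴĝ_iĝ_iᴴw)^{1/2} − (σ²wᴴw)^{1/2})⁻² ≤ ε. -/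
open scoped ComplexInnerProductSpace

/-- The minimum of `‖⟪w, g + e⟫‖ ^ 2` over the ball `‖e‖ ≤ σ` is `(‖⟪w, g⟫‖ - σ * ‖w‖) ^ 2`, as long
as the perturbation is too small to cross zero. -/
theorem isLeast_norm_inner_add_sq {𝕜 E : Type*} [RCLike 𝕜] [SeminormedAddCommGroup E]
    [InnerProductSpace 𝕜 E] {σ : ℝ} (hσ : 0 ≤ σ) (w g : E) (h : σ * ‖w‖ ≤ ‖inner 𝕜 w g‖) :
    IsLeast {x : ℝ | ∃ e : E, ‖e‖ ≤ σ ∧ x = ‖inner 𝕜 w (g + e)‖ ^ 2}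
      ((‖inner 𝕜 w g‖ - σ * ‖w‖) ^ 2) := by
  constructor
  · rcases (mul_nonneg hσ (norm_nonneg w)).eq_or_lt with h₀ | h₀
    · exact ⟨0, by simpa using hσ, by simp [← h₀]⟩
    have hw : ‖w‖ ≠ 0 := right_ne_zero_of_mul h₀.ne'
    have hc : ‖inner 𝕜 w g‖ ≠ 0 := (h₀.trans_le h).ne'
    set c : 𝕜 := inner 𝕜 w g with hc_def
    set t : ℝ := σ / (‖w‖ * ‖c‖) with ht
    have ht₀ : 0 ≤ t := by positivity
    refine ⟨-(((t : 𝕜) * c) • w), ?_, ?_⟩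
    · rw [norm_neg, norm_smul, norm_mul, RCLike.norm_ofReal, abs_of_nonneg ht₀, ht]
      apply le_of_eq
      field_simp
    · have key : inner 𝕜 w (g + -(((t : 𝕜) * c) • w)) = ((1 - t * ‖w‖ ^ 2 : ℝ) : 𝕜) * c := by
        rw [inner_add_right, inner_neg_right, inner_smul_right, inner_self_eq_norm_sq_to_K,
          ← hc_def]
        push_cast
        ring
      rw [key, norm_mul, RCLike.norm_ofReal, mul_pow, sq_abs, ← mul_pow, ht]
      congr 1
      field_simp
  · rintro _ ⟨e, he, rfl⟩
    have h₁ : ‖inner 𝕜 w e‖ ≤ σ * ‖w‖ := by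
      rw [mul_comm]
      exact (norm_inner_le_norm w e).trans (by gcongr)
    have h₂ : ‖inner 𝕜 w g‖ - ‖inner 𝕜 w e‖ ≤ ‖inner 𝕜 w (g + e)‖ := by
      rw [inner_add_right]
      exact norm_sub_le_norm_add _ _
    exact pow_le_pow_left₀ (sub_nonneg.2 h) (by linarith) 2

/-- Lemma 1: if `σ‖w‖ < |⟨w, ĝᵢ⟩|` for every `i` in a finite index set, then
`∑ i, (min_{‖e‖ ≤ σ} |⟨w, ĝᵢ + e⟩|²)⁻¹ = ∑ i, ((|⟨w, ĝᵢ⟩| − σ‖w‖)²)⁻¹`, and hence the robust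
constraint `∑ i, (min_{‖e‖ ≤ σ} |⟨w, ĝᵢ + e⟩|²)⁻¹ ≤ ε` holds iff
`∑ i, ((wᴴĝᵢĝᵢᴴw)^{1/2} − (σ²wᴴw)^{1/2})⁻² ≤ ε`. -/
theorem stmt_14 (V : ℕ) (hV : 0 < V) (σ : ℝ) (hσ : 0 ≤ σ) (w : EuclideanSpace ℂ (Fin V))
    (ι : Type*) [Fintype ι] (g : ι → EuclideanSpace ℂ (Fin V))
    (h : ∀ i : ι, σ * ‖w‖ < ‖⟪w, g i⟫‖) :
    (∑ i : ι,
        (sInf {x : ℝ | ∃ e : EuclideanSpace ℂ (Fin V), ‖e‖ ≤ σ ∧ x = ‖⟪w, g i + e⟫‖ ^ 2})⁻¹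
      = ∑ i : ι, ((‖⟪w, g i⟫‖ - σ * ‖w‖) ^ 2)⁻¹) ∧
    ∀ ε : ℝ,
      (∑ i : ι,
          (sInf {x : ℝ | ∃ e : EuclideanSpace ℂ (Fin V), ‖e‖ ≤ σ ∧ x = ‖⟪w, g i + e⟫‖ ^ 2})⁻¹
        ≤ ε) ↔
      (∑ i : ι,
          ((Real.sqrt (‖⟪w, g i⟫‖ ^ 2) - Real.sqrt (σ ^ 2 * ‖w‖ ^ 2)) ^ 2)⁻¹ ≤ ε) := by
  have key : ∀ i : ι,
      sInf {x : ℝ | ∃ e : EuclideanSpace ℂ (Fin V), ‖e‖ ≤ σ ∧ x = ‖⟪w, g i + e⟫‖ ^ 2}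
        = (‖⟪w, g i⟫‖ - σ * ‖w‖) ^ 2 :=
    fun i => (isLeast_norm_inner_add_sq hσ w (g i) (h i).le).csInf_eq
  have hsqrt : Real.sqrt (σ ^ 2 * ‖w‖ ^ 2) = σ * ‖w‖ := by
    rw [← mul_pow, Real.sqrt_sq (by positivity)]
  simp only [key, hsqrt, Real.sqrt_sq (norm_nonneg _), implies_true, and_self]
end

section
/- Let V be a positive integer, let w, ĝ ∈ ℂ^V, and let σ ≥ 0 with σ‖w‖ < |⟨w, ĝ⟩|. Then ((|⟨w, ĝ⟩| − σ‖w‖)²)⁻¹ is the greatest element of the set { (|⟨w, ĝ + e⟩|²)⁻¹ : e ∈ ℂ^V, ‖e‖ ≤ σ }; that is, this value is attained by some e with ‖e‖ ≤ σ and is an upper bound for (wᴴ(ĝ+e)(ĝ+e)ᴴw)⁻¹ over all e with ‖e‖ ≤ σ. -/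
open scoped ComplexInnerProductSpace

/-- if `σ‖w‖ < |⟨w, ĝ⟩|`, then `((|⟨w, ĝ⟩| − σ‖w‖)²)⁻¹` is the greatest
element of `{ (|⟨w, ĝ + e⟩|²)⁻¹ : ‖e‖ ≤ σ }`. -/
theorem stmt_15 (V : ℕ) (hV : 0 < V) (w g : EuclideanSpace ℂ (Fin V)) (σ : ℝ) (hσ : 0 ≤ σ)
    (h : σ * ‖w‖ < ‖⟪w, g⟫‖) :
    IsGreatest {x : ℝ | ∃ e : EuclideanSpace ℂ (Fin V), ‖e‖ ≤ σ ∧ x = (‖⟪w, g + e⟫‖ ^ 2)⁻¹}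
      (((‖⟪w, g⟫‖ - σ * ‖w‖) ^ 2)⁻¹) := by
  have hc : 0 < ‖⟪w, g⟫‖ := lt_of_le_of_lt (by positivity) h
  have hw : 0 < ‖w‖ := by
    refine norm_pos_iff.mpr ?_
    rintro rfl
    simp at hc
  have hgap : 0 < ‖⟪w, g⟫‖ - σ * ‖w‖ := sub_pos.mpr h
  constructor
  · refine ⟨-(((σ / (‖w‖ * ‖⟪w, g⟫‖) : ℝ) : ℂ) * ⟪w, g⟫) • w, ?_, ?_⟩
    · rw [norm_smul, norm_neg, norm_mul, Complex.norm_real, Real.norm_of_nonneg (by positivity)]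
      apply le_of_eq
      field_simp
    · have key : ⟪w, g + -(((σ / (‖w‖ * ‖⟪w, g⟫‖) : ℝ) : ℂ) * ⟪w, g⟫) • w⟫
          = (((‖⟪w, g⟫‖ - σ * ‖w‖) / ‖⟪w, g⟫‖ : ℝ) : ℂ) * ⟪w, g⟫ := by
        rw [inner_add_right, inner_smul_right, inner_self_eq_norm_sq_to_K]
        have hw' : (‖w‖ : ℂ) ≠ 0 := by exact_mod_cast hw.ne'
        have hc' : (‖⟪w, g⟫‖ : ℂ) ≠ 0 := by exact_mod_cast hc.ne'
        push_cast
        simp only [Complex.coe_algebraMap]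
        field_simp
        ring
      rw [key, norm_mul, Complex.norm_real, Real.norm_of_nonneg (by positivity),
        div_mul_cancel₀ _ hc.ne']
  · rintro x ⟨e, he, rfl⟩
    have hinner : ‖⟪w, e⟫‖ ≤ σ * ‖w‖ :=
      (norm_inner_le_norm w e).trans (by rw [mul_comm]; gcongr)
    have hle : ‖⟪w, g⟫‖ - σ * ‖w‖ ≤ ‖⟪w, g + e⟫‖ := by
      rw [inner_add_right]
      linarith [norm_sub_le_norm_add ⟪w, g⟫ ⟪w, e⟫]
    gcongr
end
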